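/- Assume s > 2. If the set {n ≥ 1 : 1 ≤ a_n ≤ s−2} is finite, then the value set E_{f_a} is a union of finitely many closed intervals of positive length. -/

import Mathlib

open Filter Topology MeasureTheory Set

set_option linter.unusedVariables false

/-- β_{k,n} = Σ_{i<k} q_{i,n}. -/
noncomputable def qbeta (s : ℕ) (q : Fin s → ℕ → ℝ) (k : Fin s) (n : ℕ) : ℝ :=
  ∑ i : Fin s, if i < k then q i n else 0

/-- Δ(α) = β_{α_1,1} + Σ_{n≥2} β_{α_n,n} Π_{j<n} q_{α_j,j}, with positions indexed from 0. -/
noncomputable def Delta (s : ℕ) (q : Fin s → ℕ → ℝ) (α : ℕ → Fin s) : ℝ :=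
  ∑' n : ℕ, qbeta s q (α n) n * ∏ j ∈ Finset.range n, q (α j) j

/-- the digit |a − b|. -/
def adiff {s : ℕ} (a b : Fin s) : Fin s :=
  ⟨a.1 - b.1 + (b.1 - a.1), by have ha := a.2; have hb := b.2; omega⟩

/-- The partial sums of the series `Delta`. -/
noncomputable def deltaPartial (s : ℕ) (q : Fin s → ℕ → ℝ) (α : ℕ → Fin s) (N : ℕ) : ℝ :=
  ∑ n ∈ Finset.range N, qbeta s q (α n) n * ∏ j ∈ Finset.range n, q (α j) j

/-- The length of the cylinder given by the first `N` digits of `α`. -/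
noncomputable def cylLength (s : ℕ) (q : Fin s → ℕ → ℝ) (α : ℕ → Fin s) (N : ℕ) : ℝ :=
  ∏ j ∈ Finset.range N, q (α j) j

section Cylinders

variable {s : ℕ} {q : Fin s → ℕ → ℝ}

lemma deltaPartial_succ (α : ℕ → Fin s) (N : ℕ) :
    deltaPartial s q α (N + 1) = deltaPartial s q α N + qbeta s q (α N) N * cylLength s q α N :=
  Finset.sum_range_succ _ _

lemma cylLength_succ (α : ℕ → Fin s) (N : ℕ) :
    cylLength s q α (N + 1) = cylLength s q α N * q (α N) N :=
  Finset.prod_range_succ _ _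

lemma cylLength_congr {α γ : ℕ → Fin s} {N : ℕ} (h : ∀ n < N, α n = γ n) :
    cylLength s q α N = cylLength s q γ N :=
  Finset.prod_congr rfl fun j hj => by rw [h j (Finset.mem_range.1 hj)]

lemma deltaPartial_congr {α γ : ℕ → Fin s} {N : ℕ} (h : ∀ n < N, α n = γ n) :
    deltaPartial s q α N = deltaPartial s q γ N := by
  refine Finset.sum_congr rfl fun n hn => ?_
  have hn' := Finset.mem_range.1 hn
  rw [h n hn']
  congr 1
  exact cylLength_congr fun j hj => h j (hj.trans hn')

lemma cylLength_pos (hq0 : ∀ i n, 0 < q i n) (α : ℕ → Fin s) (N : ℕ) :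
    0 < cylLength s q α N :=
  Finset.prod_pos fun _ _ => hq0 _ _

lemma qbeta_nonneg (hq0 : ∀ i n, 0 < q i n) (k : Fin s) (n : ℕ) : 0 ≤ qbeta s q k n :=
  Finset.sum_nonneg fun i _ => by
    split_ifs
    exacts [(hq0 i n).le, le_rfl]

lemma qbeta_add (k : Fin s) (n : ℕ) :
    qbeta s q k n + q k n = ∑ i : Fin s, if i ≤ k then q i n else 0 := by
  have h : q k n = ∑ i : Fin s, if i = k then q i n else 0 := by simp
  rw [h, qbeta, ← Finset.sum_add_distrib]
  refine Finset.sum_congr rfl fun i _ => ?_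
  rcases lt_trichotomy i k with hik | hik | hik
  · simp [hik, hik.le, hik.ne]
  · simp [hik]
  · simp [hik.not_ge, hik.not_gt, hik.ne']

lemma qbeta_add_le_one (hq0 : ∀ i n, 0 < q i n) (hqsum : ∀ n, ∑ i : Fin s, q i n = 1)
    (k : Fin s) (n : ℕ) : qbeta s q k n + q k n ≤ 1 := by
  rw [qbeta_add, ← hqsum n]
  refine Finset.sum_le_sum fun i _ => ?_
  split_ifs
  exacts [le_rfl, (hq0 i n).le]

lemma deltaPartial_monotone (hq0 : ∀ i n, 0 < q i n) (α : ℕ → Fin s) :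
    Monotone (deltaPartial s q α) :=
  monotone_nat_of_le_succ fun n => by
    rw [deltaPartial_succ]
    exact le_add_of_nonneg_right (mul_nonneg (qbeta_nonneg hq0 _ _) (cylLength_pos hq0 α n).le)

lemma deltaPartial_add_cylLength_antitone (hq0 : ∀ i n, 0 < q i n)
    (hqsum : ∀ n, ∑ i : Fin s, q i n = 1) (α : ℕ → Fin s) :
    Antitone fun n => deltaPartial s q α n + cylLength s q α n :=
  antitone_nat_of_succ_le fun n => by
    rw [deltaPartial_succ, cylLength_succ]
    nlinarith [cylLength_pos hq0 α n, qbeta_add_le_one hq0 hqsum (α n) n]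

lemma tendsto_deltaPartial (hq0 : ∀ i n, 0 < q i n) (hqsum : ∀ n, ∑ i : Fin s, q i n = 1)
    (α : ℕ → Fin s) : Tendsto (deltaPartial s q α) atTop (𝓝 (Delta s q α)) := by
  refine (summable_of_sum_range_le (c := 1) (fun n => ?_) fun n => ?_).hasSum.tendsto_sum_nat
  · exact mul_nonneg (qbeta_nonneg hq0 _ _) (cylLength_pos hq0 α n).le
  · have h := deltaPartial_add_cylLength_antitone hq0 hqsum α (Nat.zero_le n)
    have h0 : deltaPartial s q α 0 + cylLength s q α 0 = 1 := by
      simp [deltaPartial, cylLength]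
    have hpos := cylLength_pos hq0 α n
    change deltaPartial s q α n ≤ 1
    simp only at h
    linarith

lemma Delta_mem_cylinder (hq0 : ∀ i n, 0 < q i n) (hqsum : ∀ n, ∑ i : Fin s, q i n = 1)
    (α : ℕ → Fin s) (N : ℕ) :
    Delta s q α ∈ Icc (deltaPartial s q α N) (deltaPartial s q α N + cylLength s q α N) := by
  have ht := tendsto_deltaPartial hq0 hqsum α
  refine ⟨(deltaPartial_monotone hq0 α).ge_of_tendsto ht N, le_of_tendsto ht ?_⟩
  filter_upwards [eventually_ge_atTop N] with n hn
  have h := deltaPartial_add_cylLength_antitone hq0 hqsum α hn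
  have hpos := cylLength_pos hq0 α n
  simp only at h
  linarith

lemma tendsto_cylLength (hq0 : ∀ i n, 0 < q i n)
    (hqprod : Tendsto (fun N => ∏ n ∈ Finset.range N, ⨆ i : Fin s, q i n) atTop (𝓝 0))
    (α : ℕ → Fin s) : Tendsto (cylLength s q α) atTop (𝓝 0) :=
  squeeze_zero (fun n => (cylLength_pos hq0 α n).le)
    (fun _ => Finset.prod_le_prod (fun _ _ => (hq0 _ _).le)
      fun j _ => le_ciSup (f := fun i => q i j) (Set.finite_range _).bddAbove (α j)) hqprod

lemma exists_digit (hs : 0 < s) (hqsum : ∀ n, ∑ i : Fin s, q i n = 1) (n : ℕ) {t : ℝ}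
    (ht : t ∈ Icc (0 : ℝ) 1) : ∃ k, t ∈ Icc (qbeta s q k n) (qbeta s q k n + q k n) := by
  classical
  obtain ⟨m, rfl⟩ : ∃ m, s = m + 1 := ⟨s - 1, by omega⟩
  have hlast : t ≤ qbeta (m + 1) q (Fin.last m) n + q (Fin.last m) n := by
    rw [qbeta_add]
    simpa [Fin.le_last, hqsum n] using ht.2
  obtain ⟨k, hk, hmin⟩ := (Finset.univ.filter fun k : Fin (m + 1) =>
    t ≤ qbeta (m + 1) q k n + q k n).exists_min_image id ⟨Fin.last m, by simpa using hlast⟩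
  refine ⟨k, ?_, (Finset.mem_filter.1 hk).2⟩
  by_contra hlt
  rw [not_le] at hlt
  rcases Fin.eq_zero_or_eq_succ k with rfl | ⟨j, rfl⟩
  · simp [qbeta] at hlt
    exact hlt.not_ge ht.1
  · have hj : qbeta (m + 1) q j.castSucc n + q j.castSucc n = qbeta (m + 1) q j.succ n := by
      rw [qbeta_add, qbeta]
      simp only [Fin.le_castSucc_iff]
    have := hmin j.castSucc (by simp [hj, hlt.le])
    exact absurd this (not_le.2 (Fin.castSucc_lt_succ (i := j)))

/-- Every point of a cylinder has a digit sequence extending the prefix defining the cylinder. -/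
lemma exists_Delta_eq (hs : 0 < s) (hq0 : ∀ i n, 0 < q i n)
    (hqsum : ∀ n, ∑ i : Fin s, q i n = 1)
    (hqprod : Tendsto (fun N => ∏ n ∈ Finset.range N, ⨆ i : Fin s, q i n) atTop (𝓝 0))
    (w : ℕ → Fin s) (N : ℕ) {y : ℝ}
    (hy : y ∈ Icc (deltaPartial s q w N) (deltaPartial s q w N + cylLength s q w N)) :
    ∃ α : ℕ → Fin s, (∀ n < N, α n = w n) ∧ Delta s q α = y := by
  have hex : ∀ (n : ℕ) (t : ℝ), ∃ k, t ∈ Icc (0 : ℝ) 1 →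
      t ∈ Icc (qbeta s q k n) (qbeta s q k n + q k n) := fun n t => by
    by_cases ht : t ∈ Icc (0 : ℝ) 1
    · obtain ⟨k, hk⟩ := exists_digit hs hqsum n ht
      exact ⟨k, fun _ => hk⟩
    · exact ⟨⟨0, hs⟩, fun h => absurd h ht⟩
  choose d hd using hex
  let e : ℕ → ℝ → Fin s := fun n t => if n < N then w n else d n t
  -- the relative position of `y` in the cylinder of rank `n`
  let r : ℕ → ℝ := fun n =>
    Nat.rec y (fun n t => (t - qbeta s q (e n t) n) / q (e n t) n) n
  let α : ℕ → Fin s := fun n => e n (r n)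
  have hr : ∀ n, r (n + 1) = (r n - qbeta s q (α n) n) / q (α n) n := fun _ => rfl
  have hα : ∀ n < N, α n = w n := fun n hn => if_pos hn
  have hα' : ∀ n, N ≤ n → α n = d n (r n) := fun n hn => if_neg hn.not_gt
  have hyr : ∀ n, y = deltaPartial s q α n + cylLength s q α n * r n := by
    intro n
    induction n with
    | zero => simp [deltaPartial, cylLength, r]
    | succ n ih =>
      have hne := (hq0 (α n) n).ne'
      rw [deltaPartial_succ, cylLength_succ, hr]
      field_simp
      linarith
  have hrmem : ∀ n, N ≤ n → r n ∈ Icc (0 : ℝ) 1 := by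
    intro n hn
    induction n, hn using Nat.le_induction with
    | base =>
      rw [← deltaPartial_congr hα, ← cylLength_congr hα] at hy
      have hpos := cylLength_pos hq0 α N
      have h := hyr N
      constructor
      · by_contra! hlt
        nlinarith [hy.1]
      · by_contra! hlt
        nlinarith [hy.2]
    | succ n hn ih =>
      have h := hd n (r n) ih
      rw [← hα' n hn] at h
      rw [hr]
      have hpos := hq0 (α n) n
      exact ⟨div_nonneg (by linarith [h.1]) hpos.le, (div_le_one hpos).2 (by linarith [h.2])⟩
  refine ⟨α, hα, ?_⟩
  have hlen : Tendsto (fun n => cylLength s q α n * r n) atTop (𝓝 0) := by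
    refine squeeze_zero' ?_ ?_ (tendsto_cylLength hq0 hqprod α)
    · filter_upwards [eventually_ge_atTop N] with n hn
      exact mul_nonneg (cylLength_pos hq0 α n).le (hrmem n hn).1
    · filter_upwards [eventually_ge_atTop N] with n hn
      exact mul_le_of_le_one_right (cylLength_pos hq0 α n).le (hrmem n hn).2
  have hsum := (tendsto_deltaPartial hq0 hqsum α).add hlen
  simp only [← hyr, add_zero] at hsum
  exact tendsto_nhds_unique hsum tendsto_const_nhds

end Cylinders

/-- For an extreme digit `a`, every digit is of the form `|a - b|`. -/
lemma exists_adiff_eq {s : ℕ} {a : Fin s} (ha : ¬(1 ≤ a.1 ∧ a.1 ≤ s - 2)) (c : Fin s) :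
    ∃ b, adiff a b = c := by
  have h1 := a.2
  have h2 := c.2
  by_cases h : a.1 = 0
  · exact ⟨c, Fin.ext (by simp only [adiff]; omega)⟩
  · exact ⟨⟨s - 1 - c.1, by omega⟩, Fin.ext (by simp only [adiff]; omega)⟩

/-- if s > 2 and a_n ∈ {1,…,s−2} for only finitely many n, then the value
set E_{f_a} is a finite union of closed intervals of positive length. -/
theorem stmt14 (s : ℕ) (hs : 2 ≤ s) (q : Fin s → ℕ → ℝ)
    (hq0 : ∀ i n, 0 < q i n) (hq1 : ∀ i n, q i n < 1)
    (hqsum : ∀ n, ∑ i : Fin s, q i n = 1)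
    (hqprod : Filter.Tendsto (fun N => ∏ n ∈ Finset.range N, ⨆ i : Fin s, q i n)
      Filter.atTop (nhds 0))
    (hs' : 2 < s)
    (a : ℝ) (ha : a ∈ Set.Icc (0 : ℝ) 1) (aseq : ℕ → Fin s)
    (haseq : a = ∑' n : ℕ, (aseq n : ℝ) / (s : ℝ) ^ (n + 1))
    (hfin : {n : ℕ | 1 ≤ (aseq n).1 ∧ (aseq n).1 ≤ s - 2}.Finite) :
    ∃ S : Finset (ℝ × ℝ), (∀ p ∈ S, p.1 < p.2) ∧
      {y : ℝ | ∃ α : ℕ → Fin s, y = Delta s q (fun n => adiff (aseq n) (α n))} =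
        ⋃ p ∈ S, Set.Icc p.1 p.2 := by
  have hs0 : 0 < s := by omega
  obtain ⟨M, hM⟩ := hfin.bddAbove
  let N := M + 1
  have htail : ∀ n, N ≤ n → ¬(1 ≤ (aseq n).1 ∧ (aseq n).1 ≤ s - 2) := fun n hn h => by
    have h' : n ≤ M := hM h
    omega
  let I : (ℕ → Fin s) → ℝ × ℝ := fun β =>
    (deltaPartial s q β N, deltaPartial s q β N + cylLength s q β N)
  have hI : (range fun α : ℕ → Fin s => I fun n => adiff (aseq n) (α n)).Finite := by
    refine (Set.finite_range fun u : Fin N → Fin s =>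
      I fun n => if h : n < N then u ⟨n, h⟩ else ⟨0, hs0⟩).subset ?_
    rintro _ ⟨α, rfl⟩
    refine ⟨fun i => adiff (aseq i) (α i), ?_⟩
    simp only [I]
    rw [deltaPartial_congr (γ := fun n => adiff (aseq n) (α n)) fun n hn => by simp [hn],
      cylLength_congr (γ := fun n => adiff (aseq n) (α n)) fun n hn => by simp [hn]]
  refine ⟨hI.toFinset, ?_, ?_⟩
  · intro p hp
    obtain ⟨α, rfl⟩ := hI.mem_toFinset.1 hp
    exact lt_add_of_pos_right _ (cylLength_pos hq0 _ N)
  · ext y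
    simp only [mem_ofPred_eq, mem_iUnion, Set.Finite.mem_toFinset, exists_prop]
    constructor
    · rintro ⟨α, rfl⟩
      exact ⟨_, ⟨α, rfl⟩, Delta_mem_cylinder hq0 hqsum _ N⟩
    · rintro ⟨_, ⟨α, rfl⟩, hy⟩
      obtain ⟨β, hβ, rfl⟩ := exists_Delta_eq hs0 hq0 hqsum hqprod _ N hy
      have hex : ∀ n, ∃ b, adiff (aseq n) b = β n := fun n => by
        rcases lt_or_ge n N with hn | hn
        · exact ⟨α n, (hβ n hn).symm⟩
        · exact exists_adiff_eq (htail n hn) (β n)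
      choose γ hγ using hex
      exact ⟨γ, by simp only [hγ]⟩
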